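/- arXiv:1506.07924 — 2 statements merged into one kernel-verified Lean document; each statement's English description precedes it below -/
import Mathlib

section
/- (Lemma 3.) In a finite discounted stochastic game, for any ε > 0 there exists ρ_ε > 0 such that if ρ^i ≤ ρ_ε for all i, then |Q^i_{π^{-i}} − Q^i_{π̄^{-i}}|_∞ ≤ ε for every DM i and every deterministic joint policy π = (π^1, …, π^N), where π̄^j = (1 − ρ^j)π^j + ρ^j ν^j and ν^j assigns the uniform distribution on U^j to every state. In particular, |Q^i_{π^{-i}} − Q^i_{π̄^{-i}}|_∞ ≤ (1 − Π_{j≠i}(1 − ρ^j)) · F̄ / (1 − β^i), where F̄ < ∞ is a uniform bound (over deterministic policies and the relevant convex combinations of perturbed policies) on the corresponding Bellman operator differences. -/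
open MeasureTheory Filter
open scoped Classical

noncomputable section

namespace DQ

/-- A finite discounted stochastic game: `N` decision makers, finite state space `X`,
finite decision sets `U i`, cost functions `c`, discount factors `β`, transition kernel `P`. -/
structure Game (N : ℕ) (X : Type*) (U : Fin N → Type*) [Fintype X] where
  c : Fin N → X → (∀ i, U i) → ℝ
  β : Fin N → ℝ
  β_pos : ∀ i, 0 < β i
  β_lt_one : ∀ i, β i < 1
  P : X → (∀ i, U i) → X → ℝ
  P_nonneg : ∀ x u y, 0 ≤ P x u y
  P_sum_one : ∀ x u, ∑ y, P x u y = 1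

/-- The parameters of the learning algorithms (experimentation probabilities `ρ`,
inertias `lam`, tolerance levels `δ`, step sizes `α`, and the compact reset sets `Qset`). -/
structure Params (N : ℕ) (X : Type*) (U : Fin N → Type*)
    [Fintype X] [∀ i, Fintype (U i)] where
  ρ : Fin N → ℝ
  lam : Fin N → ℝ
  δ : Fin N → ℝ
  ρ_mem : ∀ i, 0 < ρ i ∧ ρ i < 1
  lam_mem : ∀ i, 0 < lam i ∧ lam i < 1
  δ_pos : ∀ i, 0 < δ i
  α : Fin N → ℕ → ℝ
  α_mem : ∀ i n, 0 ≤ α i n ∧ α i n ≤ 1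
  α_div : ∀ i, ¬ Summable (α i)
  α_sq : ∀ i, Summable fun n => α i n ^ 2
  Qset : (i : Fin N) → Set (X → U i → ℝ)
  Qset_compact : ∀ i, IsCompact (Qset i)
  Qset_nonempty : ∀ i, (Qset i).Nonempty

variable {N : ℕ} {X : Type*} {U : Fin N → Type*}
variable [Fintype X] [Nonempty X] [∀ i, Fintype (U i)] [∀ i, Nonempty (U i)]
variable [DecidableEq X] [∀ i, DecidableEq (U i)]

/-- A deterministic stationary policy of DM `i`, embedded as a randomized policy. -/
def detP {i : Fin N} (p : X → U i) : X → U i → ℝ := fun x a => if a = p x then 1 else 0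

/-- A deterministic joint policy viewed as a randomized policy profile. -/
def detJ (π : ∀ i, X → U i) : ∀ i, X → U i → ℝ := fun i => detP (π i)

/-- `σi` is a randomized stationary policy for DM `i`. -/
def IsRandPol {i : Fin N} (σi : X → U i → ℝ) : Prop :=
  ∀ x, (∀ a, 0 ≤ σi x a) ∧ ∑ a, σi x a = 1

/-- `σ` is a randomized stationary joint policy profile. -/
def IsProfile (σ : ∀ i, X → U i → ℝ) : Prop := ∀ i, IsRandPol (σ i)

/-- Probability of the joint decision `a` at state `x` under the profile `σ`. -/
def jointProb (σ : ∀ i, X → U i → ℝ) (x : X) (a : ∀ i, U i) : ℝ := ∏ i, σ i x (a i)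

/-- Point mass at `x`. -/
def dirac (x : X) : X → ℝ := fun y => if y = x then 1 else 0

/-- One-step evolution of the state distribution under the profile `σ`. -/
def stepOp (G : Game N X U) (σ : ∀ i, X → U i → ℝ) (μd : X → ℝ) : X → ℝ :=
  fun y => ∑ x, μd x * ∑ a, jointProb σ x a * G.P x a y

/-- Expected one-stage cost of DM `i` under the state distribution `μd` and profile `σ`. -/
def stageCost (G : Game N X U) (σ : ∀ i, X → U i → ℝ) (i : Fin N) (μd : X → ℝ) : ℝ :=
  ∑ x, μd x * ∑ a, jointProb σ x a * G.c i x a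

/-- Expected discounted cost `J^i_x(σ)` of DM `i`, starting at `x`, under the profile `σ`. -/
def J (G : Game N X U) (σ : ∀ i, X → U i → ℝ) (i : Fin N) (x : X) : ℝ :=
  ∑' t : ℕ, G.β i ^ t * stageCost G σ i ((stepOp G σ)^[t] (dirac x))

/-- `p` is a deterministic best reply of DM `i` to the profile `σ` (only the
components `σ j`, `j ≠ i`, matter): it attains the minimum of `J^i_x` over randomized
stationary policies simultaneously for every initial state `x`. -/
def IsBestReply (G : Game N X U) (i : Fin N) (σ : ∀ j, X → U j → ℝ) (p : X → U i) : Prop :=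
  ∀ (x : X) (σi : X → U i → ℝ), IsRandPol σi →
    J G (Function.update σ i (detP p)) i x ≤ J G (Function.update σ i σi) i x

/-- (Markov perfect) equilibrium among deterministic joint policies. -/
def IsEquilibrium (G : Game N X U) (π : ∀ i, X → U i) : Prop :=
  ∀ i, IsBestReply G i (detJ π) (π i)

/-- A strict best reply of DM `i` with respect to the deterministic joint policy `π`. -/
def IsStrictBestReply (G : Game N X U) (i : Fin N) (π : ∀ j, X → U j) (p : X → U i) : Prop :=
  IsBestReply G i (detJ π) p ∧
  ∃ x, J G (detJ (Function.update π i p)) i x < J G (detJ π) i x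

/-- A strict better reply of DM `i` with respect to the deterministic joint policy `π`. -/
def IsStrictBetterReply (G : Game N X U) (i : Fin N) (π : ∀ j, X → U j) (p : X → U i) : Prop :=
  (∀ x, J G (detJ (Function.update π i p)) i x ≤ J G (detJ π) i x) ∧
  ∃ x, J G (detJ (Function.update π i p)) i x < J G (detJ π) i x

/-- One step of a strict best reply path: exactly one DM deviates, to a strict best reply. -/
def StrictBRStep (G : Game N X U) (π π' : ∀ j, X → U j) : Prop :=
  ∃ i, π' = Function.update π i (π' i) ∧ π' i ≠ π i ∧ IsStrictBestReply G i π (π' i)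

/-- One step of a strict better reply path. -/
def StrictBetterStep (G : Game N X U) (π π' : ∀ j, X → U j) : Prop :=
  ∃ i, π' = Function.update π i (π' i) ∧ π' i ≠ π i ∧ IsStrictBetterReply G i π (π' i)

/-- One step of a multi-DM reply path: at least one DM deviates, and every deviating DM
switches to a reply of the kind specified by `rep`. -/
def MultiStep {N : ℕ} {X : Type*} {U : Fin N → Type*}
    (rep : (i : Fin N) → (∀ j, X → U j) → (X → U i) → Prop)
    (π π' : ∀ j, X → U j) : Prop :=
  π' ≠ π ∧ ∀ i, π' i ≠ π i → rep i π (π' i)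

/-- Weak acyclicity with respect to a step relation: from every deterministic joint policy
there is a finite path of steps ending at a deterministic equilibrium policy. -/
def WeaklyAcyclic (G : Game N X U)
    (step : (∀ j, X → U j) → (∀ j, X → U j) → Prop) : Prop :=
  ∀ π : ∀ j, X → U j, ∃ (L : ℕ) (p : ℕ → ∀ j, X → U j),
    p 0 = π ∧ (∀ k < L, step (p k) (p (k + 1))) ∧ IsEquilibrium G (p L)

/-- The optimal-Q Bellman operator `F^i_{σ^{-i}}` of DM `i` against the profile `σ`. -/
def Fopt (G : Game N X U) (σ : ∀ j, X → U j → ℝ) (i : Fin N) (Q : X → U i → ℝ) :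
    X → U i → ℝ :=
  fun x a => ∑ w : ∀ j, U j, (if w i = a then (1 : ℝ) else 0) *
    (∏ j ∈ Finset.univ.erase i, σ j x (w j)) *
    (G.c i x w + G.β i * ∑ y, G.P x w y * ⨅ v, Q y v)

/-- DM `i`'s optimal Q-factors `Q^i_{σ^{-i}}`: the unique fixed point of `Fopt`. -/
def optQ (G : Game N X U) (σ : ∀ j, X → U j → ℝ) (i : Fin N) : X → U i → ℝ :=
  if h : ∃ Q : X → U i → ℝ, Fopt G σ i Q = Q then h.choose else fun _ _ => 0

/-- The policy-evaluation Bellman operator `F^i_{(p, σ^{-i})}` used by Algorithm 2. -/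
def Feval (G : Game N X U) (σ : ∀ j, X → U j → ℝ) (i : Fin N) (p : X → U i)
    (Q : X → U i → ℝ) : X → U i → ℝ :=
  fun x a => ∑ w : ∀ j, U j, (if w i = a then (1 : ℝ) else 0) *
    (∏ j ∈ Finset.univ.erase i, σ j x (w j)) *
    (G.c i x w + G.β i * ∑ y, G.P x w y * Q y (p y))

/-- The Q-factors `Q^i_{(p, σ^{-i})}`: the unique fixed point of `Feval`. -/
def evalQ (G : Game N X U) (σ : ∀ j, X → U j → ℝ) (i : Fin N) (p : X → U i) :
    X → U i → ℝ :=
  if h : ∃ Q : X → U i → ℝ, Feval G σ i p Q = Q then h.choose else fun _ _ => 0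

/-- Maximum-norm distance between two Q-factor arrays. -/
def qdist {i : Fin N} (Q Q' : X → U i → ℝ) : ℝ := ⨆ x : X, ⨆ a : U i, |Q x a - Q' x a|

/-- The `ρ`-perturbation `π̄` of a deterministic joint policy `π`:
`π̄^j = (1 - ρ^j) π^j + ρ^j · (uniform on U^j)`. -/
def perturb (ρ : Fin N → ℝ) (π : ∀ j, X → U j) : ∀ j, X → U j → ℝ :=
  fun j x a => (1 - ρ j) * (if a = π j x then 1 else 0) + ρ j / (Fintype.card (U j) : ℝ)

/-- `δ̄`: the minimum separation between distinct entries of the optimal Q-factors over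
all DMs, states, decisions and deterministic joint policies. -/
def deltaBar (G : Game N X U) : ℝ :=
  sInf {d : ℝ | ∃ (i : Fin N) (x : X) (v w : U i) (π : ∀ j, X → U j),
    optQ G (detJ π) i x v ≠ optQ G (detJ π) i x w ∧
    d = |optQ G (detJ π) i x v - optQ G (detJ π) i x w|}

/-- `δ̌`: the minimum separation between distinct entries of the policy-evaluation
Q-factors (at the evaluated policies) over all DMs, states and deterministic policies. -/
def deltaCheck (G : Game N X U) : ℝ :=
  sInf {d : ℝ | ∃ (i : Fin N) (x : X) (p q : X → U i) (π : ∀ j, X → U j),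
    evalQ G (detJ π) i p x (p x) ≠ evalQ G (detJ π) i q x (q x) ∧
    d = |evalQ G (detJ π) i p x (p x) - evalQ G (detJ π) i q x (q x)|}

/-- Multi-step transition probability along a list of joint decisions. -/
def reachProb (G : Game N X U) : List (∀ i, U i) → X → X → ℝ
  | [], x, y => if y = x then 1 else 0
  | a :: rest, x, y => ∑ z, G.P x a z * reachProb G rest z y

/-- Assumption 1 (reachability): every state can be reached from every state with positive
probability by some finite sequence of joint decisions. -/
def Reachability (G : Game N X U) : Prop :=
  ∀ x y : X, ∃ us : List (∀ i, U i), us ≠ [] ∧ 0 < reachProb G us x y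

/-- The set of `d`-near best replies extracted from learnt Q-factors. -/
def nearBest {i : Fin N} (d : ℝ) (Q : X → U i → ℝ) : Set (X → U i) :=
  {p | ∀ x, Q x (p x) ≤ (⨅ v, Q x v) + d}

/-- Start time `t_k` of the `k`-th exploration phase: `t_0 = 0`, `t_{k+1} = t_k + T_k`. -/
def phaseStart (T : ℕ → ℕ) (k : ℕ) : ℕ := ∑ j ∈ Finset.range k, T j

/-- The number of visits of `(x_t, u_t^i)` during `[s, t)`. -/
def visits {Ω : Type*} (st : ℕ → Ω → X) (act : ℕ → Ω → ∀ i, U i) (i : Fin N)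
    (s t : ℕ) (ω : Ω) : ℕ :=
  ((Finset.Ico s t).filter fun r => st r ω = st t ω ∧ act r ω i = act t ω i).card

/-- One Q-learning update for DM `i` with step size `a` and continuation value `v`:
only the entry `(xt, ut^i)` is modified. -/
def qStepV (G : Game N X U) (i : Fin N) (a : ℝ) (Q : X → U i → ℝ) (xt : X)
    (ut : ∀ j, U j) (v : ℝ) : X → U i → ℝ :=
  fun x b => if x = xt ∧ b = ut i then
    (1 - a) * Q x b + a * (G.c i xt ut + G.β i * v) else Q x b

end DQ

namespace DQ

section Helpers

variable {N : ℕ} {X : Type*} {U : Fin N → Type*}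

lemma qdist_le [Nonempty X] [∀ i, Nonempty (U i)] {i : Fin N} {Q Q' : X → U i → ℝ} {r : ℝ}
    (h : ∀ x a, |Q x a - Q' x a| ≤ r) : qdist Q Q' ≤ r :=
  ciSup_le fun x => ciSup_le fun a => h x a

variable [∀ i, Fintype (U i)]

/-- Probability of the joint decision `w` at state `x` when DM `i` plays `a` and the others
follow the profile `σ`. -/
def replyWeight [∀ i, DecidableEq (U i)] (σ : ∀ j, X → U j → ℝ) (i : Fin N) (x : X) (a : U i)
    (w : ∀ j, U j) : ℝ :=
  (if w i = a then (1 : ℝ) else 0) * ∏ j ∈ Finset.univ.erase i, σ j x (w j)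

/-- Stage cost plus discounted optimal continuation value of DM `i` under the Q-factors `Q`. -/
def lookahead [Fintype X] (G : Game N X U) (i : Fin N) (Q : X → U i → ℝ) (x : X)
    (w : ∀ j, U j) : ℝ :=
  G.c i x w + G.β i * ∑ y, G.P x w y * ⨅ v, Q y v

lemma Fopt_apply [Fintype X] [∀ i, DecidableEq (U i)] (G : Game N X U) (σ : ∀ j, X → U j → ℝ)
    (i : Fin N) (Q : X → U i → ℝ)
    (x : X) (a : U i) :
    Fopt G σ i Q x a = ∑ w, replyWeight σ i x a w * lookahead G i Q x w := rfl

lemma replyWeight_nonneg [∀ i, DecidableEq (U i)] {σ : ∀ j, X → U j → ℝ} (hσ : IsProfile σ)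
    (i : Fin N) (x : X)
    (a : U i) (w : ∀ j, U j) : 0 ≤ replyWeight σ i x a w :=
  mul_nonneg (by split_ifs <;> norm_num) (Finset.prod_nonneg fun j _ => (hσ j x).1 _)

lemma sum_replyWeight [∀ i, DecidableEq (U i)] {σ : ∀ j, X → U j → ℝ} (hσ : IsProfile σ) (i : Fin N)
    (x : X)
    (a : U i) : ∑ w, replyWeight σ i x a w = 1 := by
  let τ : ∀ j, U j → ℝ := Function.update (fun j => σ j x) i fun b => if b = a then 1 else 0
  have hτ : ∀ w, replyWeight σ i x a w = ∏ j, τ j (w j) := by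
    intro w
    rw [← Finset.mul_prod_erase Finset.univ _ (Finset.mem_univ i), replyWeight]
    congr 1
    · simp [τ]
    · refine Finset.prod_congr rfl fun j hj => ?_
      simp [τ, Function.update_of_ne (Finset.ne_of_mem_erase hj)]
  simp_rw [hτ]
  rw [← Fintype.piFinset_univ, ← Finset.prod_univ_sum]
  refine Finset.prod_eq_one fun j _ => ?_
  rcases eq_or_ne j i with rfl | hj
  · simp [τ]
  · simp [τ, Function.update_of_ne hj, (hσ j x).2]

lemma abs_sum_sub_sum_le {ι : Type*} [Fintype ι] {W W' h : ι → ℝ} {p M : ℝ}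
    (hW : ∀ w, 0 ≤ W w) (hW1 : ∑ w, W w = 1) (hW'1 : ∑ w, W' w = 1) (hp : p ≤ 1)
    (hle : ∀ w, p * W w ≤ W' w) (hM : ∀ w, |h w| ≤ M) :
    |∑ w, W w * h w - ∑ w, W' w * h w| ≤ (1 - p) * (2 * M) := by
  have hsplit : ∑ w, W w * h w - ∑ w, W' w * h w
      = ∑ w, ((1 - p) * W w - (W' w - p * W w)) * h w := by
    rw [← Finset.sum_sub_distrib]
    exact Finset.sum_congr rfl fun w _ => by ring
  have htotal : ∑ w, ((1 - p) * W w + (W' w - p * W w)) * M = (1 - p) * (2 * M) := by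
    rw [← Finset.sum_mul, Finset.sum_add_distrib, Finset.sum_sub_distrib, ← Finset.mul_sum,
      ← Finset.mul_sum, hW1, hW'1]
    ring
  rw [hsplit, ← htotal]
  refine (Finset.abs_sum_le_sum_abs _ _).trans (Finset.sum_le_sum fun w _ => ?_)
  have h1 : 0 ≤ (1 - p) * W w := mul_nonneg (sub_nonneg.2 hp) (hW w)
  have h2 : 0 ≤ W' w - p * W w := sub_nonneg.2 (hle w)
  rw [abs_mul]
  refine mul_le_mul ?_ (hM w) (abs_nonneg _) (add_nonneg h1 h2)
  exact abs_le.2 ⟨by linarith, by linarith⟩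

lemma abs_ciInf_sub_ciInf_le {ι : Type*} [Finite ι] [Nonempty ι] {f g : ι → ℝ} {d : ℝ}
    (h : ∀ v, |f v - g v| ≤ d) : |(⨅ v, f v) - ⨅ v, g v| ≤ d := by
  have key : ∀ f g : ι → ℝ, (∀ v, |f v - g v| ≤ d) → (⨅ v, f v) - d ≤ ⨅ v, g v :=
    fun f g h => le_ciInf fun v => by
      have := ciInf_le (Set.finite_range f).bddBelow v
      linarith [(abs_le.1 (h v)).2]
  have h1 := key f g h
  have h2 := key g f fun v => by rw [abs_sub_comm]; exact h v
  exact abs_le.2 ⟨by linarith, by linarith⟩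

lemma abs_lookahead_sub_le [Fintype X] [∀ i, Nonempty (U i)] (G : Game N X U) (i : Fin N)
    {Q Q' : X → U i → ℝ} {d : ℝ} (h : ∀ x a, |Q x a - Q' x a| ≤ d) (x : X) (w : ∀ j, U j) :
    |lookahead G i Q x w - lookahead G i Q' x w| ≤ G.β i * d := by
  have hsub : lookahead G i Q x w - lookahead G i Q' x w
      = G.β i * ∑ y, G.P x w y * ((⨅ v, Q y v) - ⨅ v, Q' y v) := by
    simp only [lookahead, mul_sub, Finset.sum_sub_distrib]
    ring
  rw [hsub, abs_mul, abs_of_pos (G.β_pos i)]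
  refine mul_le_mul_of_nonneg_left ?_ (G.β_pos i).le
  calc _ ≤ ∑ y, |G.P x w y * ((⨅ v, Q y v) - ⨅ v, Q' y v)| := Finset.abs_sum_le_sum_abs _ _
    _ ≤ ∑ y, G.P x w y * d := Finset.sum_le_sum fun y _ => by
        rw [abs_mul, abs_of_nonneg (G.P_nonneg x w y)]
        exact mul_le_mul_of_nonneg_left (abs_ciInf_sub_ciInf_le (h y)) (G.P_nonneg x w y)
    _ = d := by rw [← Finset.sum_mul, G.P_sum_one, one_mul]

lemma abs_Fopt_sub_le [Fintype X] [∀ i, DecidableEq (U i)] [∀ i, Nonempty (U i)] (G : Game N X U)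
    {σ : ∀ j, X → U j → ℝ}
    (hσ : IsProfile σ) (i : Fin N) {Q Q' : X → U i → ℝ} {d : ℝ}
    (h : ∀ x a, |Q x a - Q' x a| ≤ d) (x : X) (a : U i) :
    |Fopt G σ i Q x a - Fopt G σ i Q' x a| ≤ G.β i * d := by
  simp only [Fopt_apply, ← Finset.sum_sub_distrib, ← mul_sub]
  calc _ ≤ ∑ w, |replyWeight σ i x a w * (lookahead G i Q x w - lookahead G i Q' x w)| :=
        Finset.abs_sum_le_sum_abs _ _
    _ ≤ ∑ w, replyWeight σ i x a w * (G.β i * d) := Finset.sum_le_sum fun w _ => by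
        rw [abs_mul, abs_of_nonneg (replyWeight_nonneg hσ i x a w)]
        exact mul_le_mul_of_nonneg_left (abs_lookahead_sub_le G i h x w)
          (replyWeight_nonneg hσ i x a w)
    _ = G.β i * d := by rw [← Finset.sum_mul, sum_replyWeight hσ, one_mul]

lemma Fopt_optQ [Fintype X] [∀ i, DecidableEq (U i)] [∀ i, Nonempty (U i)] (G : Game N X U)
    {σ : ∀ j, X → U j → ℝ}
    (hσ : IsProfile σ) (i : Fin N) : Fopt G σ i (optQ G σ i) = optQ G σ i := by
  have hcontr : ContractingWith ⟨G.β i, (G.β_pos i).le⟩ (Fopt G σ i) := by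
    refine ⟨G.β_lt_one i, LipschitzWith.of_dist_le_mul fun Q Q' => ?_⟩
    have hd : ∀ x a, |Q x a - Q' x a| ≤ dist Q Q' := fun x a =>
      (dist_le_pi_dist (Q x) (Q' x) a).trans (dist_le_pi_dist Q Q' x)
    have hnonneg : 0 ≤ G.β i * dist Q Q' := mul_nonneg (G.β_pos i).le dist_nonneg
    exact (dist_pi_le_iff hnonneg).2 fun x => (dist_pi_le_iff hnonneg).2 fun a =>
      abs_Fopt_sub_le G hσ i hd x a
  have hex : ∃ Q, Fopt G σ i Q = Q := ⟨_, hcontr.fixedPoint_isFixedPt⟩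
  rw [optQ, dif_pos hex]
  exact hex.choose_spec

lemma abs_sub_le_qdist [Fintype X] {i : Fin N} (Q Q' : X → U i → ℝ) (x : X) (a : U i) :
    |Q x a - Q' x a| ≤ qdist Q Q' :=
  (le_ciSup (f := fun a => |Q x a - Q' x a|) (Set.finite_range _).bddAbove a).trans
    (le_ciSup (f := fun x => ⨆ a, |Q x a - Q' x a|) (Set.finite_range _).bddAbove x)

lemma isProfile_detJ [∀ i, DecidableEq (U i)] (π : ∀ j, X → U j) : IsProfile (detJ π) := fun j x =>
  ⟨fun a => by unfold detJ detP; split_ifs <;> norm_num, by simp [detJ, detP]⟩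

lemma isProfile_perturb [∀ i, DecidableEq (U i)] [∀ i, Nonempty (U i)] {ρ : Fin N → ℝ}
    (hρ : ∀ j, 0 < ρ j ∧ ρ j < 1)
    (π : ∀ j, X → U j) : IsProfile (perturb ρ π) := by
  refine fun j x => ⟨fun a => ?_, ?_⟩
  · have h1 : 0 ≤ 1 - ρ j := sub_nonneg.2 (hρ j).2.le
    have h2 := (hρ j).1.le
    unfold perturb
    split_ifs <;> positivity
  · have hcard : (Fintype.card (U j) : ℝ) ≠ 0 := Nat.cast_ne_zero.2 Fintype.card_ne_zero
    simp only [perturb, Finset.sum_add_distrib, ← Finset.mul_sum, Finset.sum_ite_eq',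
      Finset.mem_univ, if_true, Finset.sum_const, Finset.card_univ, nsmul_eq_mul]
    field_simp
    ring

lemma mul_replyWeight_detJ_le [∀ i, DecidableEq (U i)] {ρ : Fin N → ℝ} (hρ : ∀ j, 0 < ρ j ∧ ρ j < 1)
    (π : ∀ j, X → U j) (i : Fin N) (x : X) (a : U i) (w : ∀ j, U j) :
    (∏ j ∈ Finset.univ.erase i, (1 - ρ j)) * replyWeight (detJ π) i x a w
      ≤ replyWeight (perturb ρ π) i x a w := by
  rw [replyWeight, replyWeight, mul_left_comm, ← Finset.prod_mul_distrib]
  refine mul_le_mul_of_nonneg_left (Finset.prod_le_prod (fun j _ => ?_) fun j _ => ?_)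
    (by split_ifs <;> norm_num)
  · exact mul_nonneg (sub_nonneg.2 (hρ j).2.le) ((isProfile_detJ π j x).1 _)
  · exact le_add_of_nonneg_right (div_nonneg (hρ j).1.le (Nat.cast_nonneg _))

lemma one_sub_prod_one_sub_le_sum {ι : Type*} (s : Finset ι) {r : ι → ℝ}
    (h0 : ∀ j, 0 ≤ r j) (h1 : ∀ j, r j ≤ 1) : 1 - ∏ j ∈ s, (1 - r j) ≤ ∑ j ∈ s, r j := by
  induction s using Finset.induction_on with
  | empty => simp
  | insert k s hk ih =>
    rw [Finset.prod_insert hk, Finset.sum_insert hk]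
    have hle : ∏ j ∈ s, (1 - r j) ≤ 1 :=
      Finset.prod_le_one (fun j _ => sub_nonneg.2 (h1 j)) fun j _ => by linarith [h0 j]
    nlinarith [mul_le_mul_of_nonneg_left hle (h0 k)]

/-- The optimal continuation values against deterministic joint policies are bounded. -/
lemma exists_lookahead_bound [Fintype X] [∀ i, DecidableEq (U i)] (G : Game N X U) :
    ∃ M : ℝ, 0 ≤ M ∧ ∀ (i : Fin N) (π : ∀ j, X → U j) (x : X) (w : ∀ j, U j),
      |lookahead G i (optQ G (detJ π) i) x w| ≤ M := by
  let f : Fin N × (∀ j, X → U j) × X × (∀ j, U j) → ℝ := fun q =>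
    |lookahead G q.1 (optQ G (detJ q.2.1) q.1) q.2.2.1 q.2.2.2|
  exact ⟨∑ q, f q, Finset.sum_nonneg fun q _ => abs_nonneg _, fun i π x w =>
    Finset.single_le_sum (f := f) (fun q _ => abs_nonneg _) (Finset.mem_univ (i, π, x, w))⟩

/-- A fixed point of a contraction moves by at most `1 / (1 - β)` times the perturbation of the
operator. -/
lemma qdist_optQ_le [Fintype X] [∀ i, DecidableEq (U i)] [Nonempty X] [∀ i, Nonempty (U i)]
    (G : Game N X U)
    {σ τ : ∀ j, X → U j → ℝ} (hσ : IsProfile σ) (hτ : IsProfile τ) (i : Fin N) {r : ℝ}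
    (h : ∀ x a, |Fopt G σ i (optQ G σ i) x a - Fopt G τ i (optQ G σ i) x a| ≤ r) :
    qdist (optQ G σ i) (optQ G τ i) ≤ r / (1 - G.β i) := by
  have hβ : 0 < 1 - G.β i := sub_pos.2 (G.β_lt_one i)
  have hstep : qdist (optQ G σ i) (optQ G τ i)
      ≤ r + G.β i * qdist (optQ G σ i) (optQ G τ i) := by
    refine qdist_le fun x a => ?_
    have h1 := h x a
    have h2 := abs_Fopt_sub_le G hτ i (abs_sub_le_qdist (optQ G σ i) (optQ G τ i)) x a
    rw [Fopt_optQ G hσ] at h1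
    rw [Fopt_optQ G hτ] at h2
    exact (abs_sub_le _ _ _).trans (add_le_add h1 h2)
  rw [le_div_iff₀ hβ]
  linarith

end Helpers

/-- Lemma 3: (a) the optimal Q-factors against a deterministic joint policy and against
its `ρ`-perturbation are uniformly close when the experimentation probabilities are
small; (b) quantitatively, `|Q^i_{π^{-i}} - Q^i_{π̄^{-i}}|_∞ ≤ (1 - Π_{j≠i}(1-ρ^j)) F̄ / (1 - β^i)`,
where `F̄ < ∞` is a uniform bound on the corresponding Bellman operator differences. -/
theorem stmt9
    {N : ℕ} {X : Type} {U : Fin N → Type}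
    [Fintype X] [Nonempty X] [∀ i, Fintype (U i)] [∀ i, Nonempty (U i)]
    [DecidableEq X] [∀ i, DecidableEq (U i)]
    (G : Game N X U) :
    (∀ ε : ℝ, 0 < ε → ∃ ρε : ℝ, 0 < ρε ∧
      ∀ ρ : Fin N → ℝ, (∀ j, 0 < ρ j ∧ ρ j < 1) → (∀ j, ρ j ≤ ρε) →
        ∀ (i : Fin N) (π : ∀ j, X → U j),
          qdist (optQ G (detJ π) i) (optQ G (perturb ρ π) i) ≤ ε) ∧
    (∃ Fbar : ℝ,
      (∀ (i : Fin N) (π : ∀ j, X → U j) (σ : ∀ j, X → U j → ℝ), IsProfile σ →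
        qdist (Fopt G (detJ π) i (optQ G (detJ π) i))
          (Fopt G σ i (optQ G (detJ π) i)) ≤ Fbar) ∧
      ∀ ρ : Fin N → ℝ, (∀ j, 0 < ρ j ∧ ρ j < 1) →
        ∀ (i : Fin N) (π : ∀ j, X → U j),
          qdist (optQ G (detJ π) i) (optQ G (perturb ρ π) i)
            ≤ (1 - ∏ j ∈ Finset.univ.erase i, (1 - ρ j)) * Fbar / (1 - G.β i)) := by
  obtain ⟨M, hM0, hM⟩ := exists_lookahead_bound G
  have hprod_le : ∀ ρ : Fin N → ℝ, (∀ j, 0 < ρ j ∧ ρ j < 1) → ∀ i,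
      ∏ j ∈ Finset.univ.erase i, (1 - ρ j) ≤ 1 := fun ρ hρ i =>
    Finset.prod_le_one (fun j _ => sub_nonneg.2 (hρ j).2.le) fun j _ => by linarith [(hρ j).1]
  have hbound : ∀ ρ : Fin N → ℝ, (∀ j, 0 < ρ j ∧ ρ j < 1) →
      ∀ (i : Fin N) (π : ∀ j, X → U j), qdist (optQ G (detJ π) i) (optQ G (perturb ρ π) i)
        ≤ (1 - ∏ j ∈ Finset.univ.erase i, (1 - ρ j)) * (2 * M) / (1 - G.β i) :=
    fun ρ hρ i π => qdist_optQ_le G (isProfile_detJ π) (isProfile_perturb hρ π) i fun x a =>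
      abs_sum_sub_sum_le (replyWeight_nonneg (isProfile_detJ π) i x a)
        (sum_replyWeight (isProfile_detJ π) i x a)
        (sum_replyWeight (isProfile_perturb hρ π) i x a) (hprod_le ρ hρ i)
        (mul_replyWeight_detJ_le hρ π i x a) (hM i π x)
  refine ⟨fun ε hε => ?_, 2 * M, fun i π σ hσ => qdist_le fun x a => ?_, hbound⟩
  · have hβ : ∀ i, 0 < 1 - G.β i := fun i => sub_pos.2 (G.β_lt_one i)
    let B : ℝ := ∑ i, (1 - G.β i)⁻¹
    have hB0 : 0 ≤ B := Finset.sum_nonneg fun i _ => (inv_pos.2 (hβ i)).le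
    have hB : ∀ i, (1 - G.β i)⁻¹ ≤ B := fun i =>
      Finset.single_le_sum (fun j _ => (inv_pos.2 (hβ j)).le) (Finset.mem_univ i)
    let K : ℝ := N * (2 * M) * B
    have hK : 0 ≤ K := by positivity
    refine ⟨ε / (K + 1), by positivity, fun ρ hρ hle i π => (hbound ρ hρ i π).trans ?_⟩
    have hsum : 1 - ∏ j ∈ Finset.univ.erase i, (1 - ρ j) ≤ N * (ε / (K + 1)) :=
      calc _ ≤ ∑ j ∈ Finset.univ.erase i, ρ j :=
            one_sub_prod_one_sub_le_sum _ (fun j => (hρ j).1.le) fun j => (hρ j).2.le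
        _ ≤ ∑ j, ρ j := Finset.sum_le_sum_of_subset_of_nonneg (Finset.erase_subset _ _)
            fun j _ _ => (hρ j).1.le
        _ ≤ ∑ _j : Fin N, ε / (K + 1) := Finset.sum_le_sum fun j _ => hle j
        _ = N * (ε / (K + 1)) := by simp
    calc _ ≤ N * (ε / (K + 1)) * (2 * M) * B := by
          rw [div_eq_mul_inv]
          exact mul_le_mul (mul_le_mul_of_nonneg_right hsum (by positivity)) (hB i)
            (inv_pos.2 (hβ i)).le (by positivity)
      _ = K * ε / (K + 1) := by simp only [K]; ring
      _ ≤ ε := by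
          rw [div_le_iff₀ (by positivity)]
          nlinarith
  · have h := abs_sum_sub_sum_le (p := 0) (replyWeight_nonneg (isProfile_detJ π) i x a)
      (sum_replyWeight (isProfile_detJ π) i x a) (sum_replyWeight hσ i x a) zero_le_one
      (fun w => by rw [zero_mul]; exact replyWeight_nonneg hσ i x a w) (hM i π x)
    rwa [sub_zero, one_mul] at h

end DQ
end
end

section
/- (Convergence of the best reply process with inertia.) Consider a finite discounted stochastic game that is weakly acyclic under strict best replies, and suppose each DM i runs the Best Reply Process with Inertia: starting from an arbitrary deterministic policy π_0^i, at each step k, if π_k^i ∈ Π^i_{π_k^{-i}} then π_{k+1}^i = π_k^i; otherwise π_{k+1}^i = π_k^i with probability λ^i and π_{k+1}^i is a uniformly random member of Π^i_{π_k^{-i}} with probability (1 − λ^i)/|Π^i_{π_k^{-i}}|, where λ^i ∈ (0,1) is DM i's inertia. Then the joint policy process is absorbed at an equilibrium in finitely many steps with probability one: P[π_k = π* for some π* ∈ Π_eq and all sufficiently large k] = 1. -/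
open MeasureTheory Filter
open scoped Classical

noncomputable section

namespace DQ

variable {N : ℕ} {X : Type*} {U : Fin N → Type*}
variable [Fintype X] [Nonempty X] [∀ i, Fintype (U i)] [∀ i, Nonempty (U i)]
variable [DecidableEq X] [∀ i, DecidableEq (U i)]

/-- The set of deterministic best replies of DM `i` to the deterministic joint policy `π`. -/
def bestReplies (G : Game N X U) (i : Fin N) (π : ∀ j, X → U j) : Set (X → U i) :=
  {p | IsBestReply G i (detJ π) p}

/-- A run of the Best Reply Process with Inertia: all DMs update simultaneously and
independently; a DM whose current policy is a best reply keeps it, and otherwise keeps it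
with probability `λ^i` and switches to a uniformly random best reply with the remaining
probability. -/
structure BRRun (G : Game N X U) (Ω : Type*) [MeasurableSpace Ω]
    (μ : MeasureTheory.Measure Ω) where
  lam : Fin N → ℝ
  lam_mem : ∀ i, 0 < lam i ∧ lam i < 1
  filt : ℕ → MeasurableSpace Ω
  filt_mono : Monotone filt
  filt_le : ∀ k, filt k ≤ (inferInstance : MeasurableSpace Ω)
  pol : (i : Fin N) → ℕ → Ω → X → U i
  pol_adapted : ∀ i k p, MeasurableSet[filt k] {ω | pol i k ω = p}
  pol_law : ∀ k (p : ∀ i, X → U i),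
    (μ[(fun ω => if ∀ i, pol i (k + 1) ω = p i then (1 : ℝ) else 0) | filt k])
      =ᵐ[μ] fun ω => ∏ i,
        (if pol i k ω ∈ bestReplies G i (fun j => pol j k ω) then
          (if p i = pol i k ω then (1 : ℝ) else 0)
        else
          (if p i = pol i k ω then lam i else 0) +
          (1 - lam i) * (if p i ∈ bestReplies G i (fun j => pol j k ω) then
            1 / ((bestReplies G i (fun j => pol j k ω)).ncard : ℝ) else 0))

set_option linter.unusedSectionVars false

/-- A finite-state process whose one-step joint laws are governed by the weights `K`, and for which
some path of positive weight leads from every state into a set `A` of absorbing states, is almost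
surely eventually constant with value in `A`. -/
theorem ae_eventually_const_of_absorbing {S Ω : Type*} [Fintype S] [MeasurableSpace Ω]
    (μ : Measure Ω) [IsProbabilityMeasure μ] (Z : ℕ → Ω → S) (K : S → S → ℝ) (A : Set S)
    (hZ : ∀ k s, MeasurableSet {ω | Z k ω = s})
    (hK : ∀ k s t, μ.real {ω | Z k ω = s ∧ Z (k + 1) ω = t} = K s t * μ.real {ω | Z k ω = s})
    (hA : ∀ a ∈ A, K a a = 1)
    (hpath : ∀ s, ∃ (L : ℕ) (p : ℕ → S), p 0 = s ∧ (∀ k < L, 0 < K (p k) (p (k + 1))) ∧ p L ∈ A) :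
    ∀ᵐ ω ∂μ, ∃ a ∈ A, ∃ k₀ : ℕ, ∀ k, k₀ ≤ k → Z k ω = a := by
  have hstay : ∀ᵐ ω ∂μ, ∀ k, Z k ω ∈ A → Z (k + 1) ω = Z k ω := by
    have h1 : ∀ᵐ ω ∂μ, ∀ k : ℕ, ∀ a : A, ¬ (Z k ω = a ∧ ¬ Z (k + 1) ω = a) := by
      refine ae_all_iff.2 fun k => ae_all_iff.2 fun a => ?_
      have hsum := measureReal_inter_add_sdiff (μ := μ) (s := {ω | Z k ω = a})
        (hZ (k + 1) (a : S))
      have hjoint := hK k a a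
      rw [hA a a.2, one_mul] at hjoint
      have hinter : {ω | Z k ω = a} ∩ {ω | Z (k + 1) ω = a}
          = {ω | Z k ω = a ∧ Z (k + 1) ω = a} := rfl
      rw [hinter, hjoint] at hsum
      have hzero : μ.real ({ω | Z k ω = a} \ {ω | Z (k + 1) ω = a}) = 0 := by linarith
      rw [ae_iff]
      simp only [not_not]
      exact (measureReal_eq_zero_iff).1 hzero
    filter_upwards [h1] with ω hω k hk
    by_contra hne
    exact hω k ⟨_, hk⟩ ⟨rfl, hne⟩
  have hinc : ∀ k s a, s ∉ A → a ∈ A →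
      μ.real {ω | Z k ω ∈ A} + K s a * μ.real {ω | Z k ω = s}
        ≤ μ.real {ω | Z (k + 1) ω ∈ A} := fun k s a hs ha => by
    rw [← hK, ← measureReal_union]
    · refine ENNReal.toReal_mono (measure_ne_top _ _) (measure_mono_ae ?_)
      filter_upwards [hstay] with ω hω h
      rcases h with h | h
      · change Z (k + 1) ω ∈ A
        rw [hω k h]; exact h
      · change Z (k + 1) ω ∈ A
        rw [h.2]; exact ha
    · refine Set.disjoint_left.2 fun ω h1 h2 => hs ?_
      rw [← h2.1]; exact h1
    · exact (hZ k s).inter (hZ (k + 1) a)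
  have hmono : Monotone fun k => μ.real {ω | Z k ω ∈ A} := monotone_nat_of_le_succ fun k =>
    ENNReal.toReal_mono (measure_ne_top _ _) (measure_mono_ae (by
      filter_upwards [hstay] with ω hω h
      change Z (k + 1) ω ∈ A
      rw [hω k h]; exact h))
  have hdiff : Tendsto (fun k => μ.real {ω | Z (k + 1) ω ∈ A} - μ.real {ω | Z k ω ∈ A})
      atTop (nhds 0) := by
    have h := tendsto_atTop_ciSup hmono ⟨1, by rintro _ ⟨k, rfl⟩; exact measureReal_le_one⟩
    simpa using (h.comp (tendsto_add_atTop_nat 1)).sub h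
  have hvanish : ∀ s, s ∉ A → Tendsto (fun k => μ.real {ω | Z k ω = s}) atTop (nhds 0) := by
    intro s
    obtain ⟨L, p, rfl, hp, hL⟩ := hpath s
    have key : ∀ n ≤ L, p n ∉ A →
        Tendsto (fun k => μ.real {ω | Z k ω = p n}) atTop (nhds 0) := by
      intro n hn
      induction hn using Nat.decreasingInduction with
      | self => exact fun h => absurd hL h
      | of_succ n hn ih =>
        intro hnA
        have hpos := hp n hn
        by_cases hA' : p (n + 1) ∈ A
        · refine squeeze_zero (fun _ => measureReal_nonneg) (fun k => ?_)
            (by simpa using hdiff.div_const (K (p n) (p (n + 1))))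
          rw [le_div_iff₀ hpos]
          linarith [hinc k _ _ hnA hA']
        · have hnext := ((ih hA').comp (tendsto_add_atTop_nat 1)).div_const (K (p n) (p (n + 1)))
          rw [zero_div] at hnext
          refine squeeze_zero (fun _ => measureReal_nonneg) (fun k => ?_) hnext
          simp only [Function.comp_apply]
          rw [le_div_iff₀ hpos, mul_comm, ← hK]
          exact measureReal_mono fun ω h => h.2
    exact key 0 (Nat.zero_le _)
  have hout : Tendsto (fun k => μ.real {ω | Z k ω ∉ A}) atTop (nhds 0) := by
    have hsum : Tendsto (fun k => ∑ s ∈ Finset.univ.filter (· ∉ A), μ.real {ω | Z k ω = s})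
        atTop (nhds 0) := by
      simpa using tendsto_finsetSum (Finset.univ.filter (· ∉ A))
        fun s hs => hvanish s (Finset.mem_filter.1 hs).2
    refine squeeze_zero (fun _ => measureReal_nonneg) (fun k => ?_) hsum
    refine (measureReal_mono ?_ (measure_ne_top _ _)).trans (measureReal_biUnion_finset_le _ _)
    intro ω h
    simpa using h
  have hnever : μ.real {ω | ∀ k, Z k ω ∉ A} = 0 :=
    le_antisymm (ge_of_tendsto' hout fun k => measureReal_mono fun ω h => h k) measureReal_nonneg
  have hhit : ∀ᵐ ω ∂μ, ∃ k, Z k ω ∈ A := by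
    rw [ae_iff]
    simpa using (measureReal_eq_zero_iff).1 hnever
  filter_upwards [hstay, hhit] with ω hs ⟨k₀, hk₀⟩
  refine ⟨Z k₀ ω, hk₀, k₀, fun k hk => ?_⟩
  induction k, hk using Nat.le_induction with
  | base => rfl
  | succ k _ ih => rw [hs k (by rw [ih]; exact hk₀), ih]

theorem detJ_update (π : ∀ j, X → U j) (i : Fin N) (p : X → U i) :
    detJ (Function.update π i p) = Function.update (detJ π) i (detP p) := by
  funext j
  by_cases h : j = i
  · subst h; simp [detJ]
  · simp [detJ, h]

theorem isRandPol_detP {i : Fin N} (p : X → U i) : IsRandPol (i := i) (detP p) := fun x =>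
  ⟨fun a => by unfold detP; split_ifs <;> norm_num, by simp [detP]⟩

/-- A DM who has a strict best reply is not already playing a best reply. -/
theorem IsStrictBestReply.not_isBestReply {G : Game N X U} {i : Fin N} {π : ∀ j, X → U j}
    {p : X → U i} (h : IsStrictBestReply G i π p) : ¬ IsBestReply G i (detJ π) (π i) := by
  intro hbr
  obtain ⟨-, x, hx⟩ := h
  have hle := hbr x (detP p) (isRandPol_detP p)
  rw [← detJ_update, ← detJ_update, Function.update_eq_self] at hle
  exact absurd hx (not_lt.2 hle)

/-- The transition probability of DM `i` in the Best Reply Process with inertia `l`. -/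
def brFactor (G : Game N X U) (l : ℝ) (i : Fin N) (π : ∀ j, X → U j) (p : X → U i) : ℝ :=
  if π i ∈ bestReplies G i π then (if p = π i then (1 : ℝ) else 0)
  else (if p = π i then l else 0) + (1 - l) * (if p ∈ bestReplies G i π then
    1 / ((bestReplies G i π).ncard : ℝ) else 0)

theorem brFactor_self_of_mem {G : Game N X U} {i : Fin N} {π : ∀ j, X → U j} (l : ℝ)
    (h : π i ∈ bestReplies G i π) : brFactor G l i π (π i) = 1 := by
  simp [brFactor, h]

theorem brFactor_self_pos {G : Game N X U} {l : ℝ} (hl : 0 < l ∧ l < 1) (i : Fin N)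
    (π : ∀ j, X → U j) : 0 < brFactor G l i π (π i) := by
  by_cases h : π i ∈ bestReplies G i π
  · rw [brFactor_self_of_mem l h]; norm_num
  · simpa [brFactor, h] using hl.1

theorem brFactor_pos_of_isStrictBestReply {G : Game N X U} {l : ℝ} (hl : 0 < l ∧ l < 1)
    {i : Fin N} {π : ∀ j, X → U j} {p : X → U i} (h : IsStrictBestReply G i π p) :
    0 < brFactor G l i π p := by
  have hmem : p ∈ bestReplies G i π := h.1
  have hnot : π i ∉ bestReplies G i π := h.not_isBestReply
  have hcard : (0 : ℝ) < (bestReplies G i π).ncard :=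
    Nat.cast_pos.2 ((Set.ncard_pos (Set.toFinite _)).2 ⟨p, hmem⟩)
  have hswitch : 0 < (1 - l) * (1 / ((bestReplies G i π).ncard : ℝ)) :=
    mul_pos (sub_pos.2 hl.2) (one_div_pos.2 hcard)
  have hkeep : 0 ≤ if p = π i then l else 0 := by split_ifs <;> linarith [hl.1]
  simp only [brFactor, if_neg hnot, if_pos hmem]
  linarith

/-- The joint transition probability of the Best Reply Process with inertias `lam`. -/
def brKernel (G : Game N X U) (lam : Fin N → ℝ) (π p : ∀ j, X → U j) : ℝ :=
  ∏ i, brFactor G (lam i) i π (p i)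

theorem brKernel_pos_of_strictBRStep {G : Game N X U} {lam : Fin N → ℝ}
    (hlam : ∀ i, 0 < lam i ∧ lam i < 1) {π p : ∀ j, X → U j} (h : StrictBRStep G π p) :
    0 < brKernel G lam π p := by
  obtain ⟨i, hp, -, hbr⟩ := h
  refine Finset.prod_pos fun j _ => ?_
  by_cases hj : j = i
  · subst hj; exact brFactor_pos_of_isStrictBestReply (hlam j) hbr
  · have hpj : p j = π j := by rw [hp]; simp [hj]
    rw [hpj]; exact brFactor_self_pos (hlam j) j π

theorem BRRun.measurableSet_pol_eq {G : Game N X U} {Ω : Type*} [MeasurableSpace Ω]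
    {μ : Measure Ω} (R : BRRun G Ω μ) (k : ℕ) (s : ∀ j, X → U j) :
    MeasurableSet[R.filt k] {ω | (fun i => R.pol i k ω) = s} := by
  have : {ω | (fun i => R.pol i k ω) = s} = ⋂ i, {ω | R.pol i k ω = s i} := by
    ext; simp [funext_iff (f := fun i => R.pol i k _)]
  rw [this]
  exact MeasurableSet.iInter fun i => R.pol_adapted i k (s i)

theorem BRRun.measureReal_pol_succ {G : Game N X U} {Ω : Type*} [MeasurableSpace Ω]
    {μ : Measure Ω} [IsProbabilityMeasure μ] (R : BRRun G Ω μ) (k : ℕ) (s t : ∀ j, X → U j) :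
    μ.real {ω | (fun i => R.pol i k ω) = s ∧ (fun i => R.pol i (k + 1) ω) = t}
      = brKernel G R.lam s t * μ.real {ω | (fun i => R.pol i k ω) = s} := by
  have hms := R.measurableSet_pol_eq k s
  have hms' := R.filt_le k _ hms
  have hmt := R.filt_le (k + 1) _ (R.measurableSet_pol_eq (k + 1) t)
  have hind : (fun ω => if ∀ i, R.pol i (k + 1) ω = t i then (1 : ℝ) else 0)
      = {ω | (fun i => R.pol i (k + 1) ω) = t}.indicator fun _ => (1 : ℝ) := by
    funext ω
    simp only [Set.indicator_apply, Set.mem_ofPred_eq, funext_iff (f := fun i => R.pol i (k + 1) ω)]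
  have hlaw := R.pol_law k t
  rw [hind] at hlaw
  have hint := setIntegral_condExp (μ := μ) (R.filt_le k)
    ((integrable_const (1 : ℝ)).indicator hmt) hms
  rw [setIntegral_indicator hmt, setIntegral_const, smul_eq_mul, mul_one] at hint
  refine hint.symm.trans ?_
  have hcongr : ∀ᵐ ω ∂μ, ω ∈ {ω | (fun i => R.pol i k ω) = s} →
      (μ[{ω | (fun i => R.pol i (k + 1) ω) = t}.indicator (fun _ => (1 : ℝ)) | R.filt k]) ω
        = brKernel G R.lam s t := by
    filter_upwards [hlaw] with ω hω hs
    rw [hω, ← (hs : (fun i => R.pol i k ω) = s)]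
    rfl
  rw [setIntegral_congr_ae hms' hcongr, setIntegral_const, smul_eq_mul, mul_comm]

/-- Convergence of the best reply process with inertia: in a discounted stochastic game
that is weakly acyclic under strict best replies, the joint policy process is absorbed at a
deterministic equilibrium policy in finitely many steps with probability one. -/
theorem stmt14
    {N : ℕ} {X : Type} {U : Fin N → Type}
    [Fintype X] [Nonempty X] [∀ i, Fintype (U i)] [∀ i, Nonempty (U i)]
    [DecidableEq X] [∀ i, DecidableEq (U i)]
    (G : Game N X U)
    (hWA : WeaklyAcyclic G (StrictBRStep G))
    {Ω : Type} [MeasurableSpace Ω] (μ : MeasureTheory.Measure Ω)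
    [MeasureTheory.IsProbabilityMeasure μ]
    (R : BRRun G Ω μ) :
    μ {ω | ∃ πs : ∀ i, X → U i, IsEquilibrium G πs ∧
        ∃ K : ℕ, ∀ k, K ≤ k → (fun i => R.pol i k ω) = πs} = 1 := by
  have h := ae_eventually_const_of_absorbing μ (fun k ω i => R.pol i k ω) (brKernel G R.lam)
    {π | IsEquilibrium G π} (fun k s => R.filt_le k _ (R.measurableSet_pol_eq k s))
    R.measureReal_pol_succ
    (fun π hπ => Finset.prod_eq_one fun i _ => brFactor_self_of_mem _ (hπ i))
    (fun π => by
      obtain ⟨L, p, h0, hstep, hL⟩ := hWA π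
      exact ⟨L, p, h0, fun k hk => brKernel_pos_of_strictBRStep R.lam_mem (hstep k hk), hL⟩)
  exact (measure_congr (eventuallyEq_univ.2 h)).trans measure_univ


end DQ
end
end
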